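/- (Stone–von Neumann) Let V be a finite-dimensional complex vector space and τ : H → GL(V) a group homomorphism such that τ((0,0), z) = ψ(z)·Id for all z ∈ ZMod p and such that the only τ-invariant subspaces of V are {0} and V. Then τ is isomorphic to the standard realization: there exists a linear equivalence Φ : ℂ(ZMod p) ≃ V with Φ ∘ π(h) = τ(h) ∘ Φ for every h ∈ H. -/

import Mathlib

open scoped BigOperators

noncomputable section

namespace DFTWeil

open scoped Classical

/-- Multiplication of the Heisenberg group `H = (V × V) × Z`,
`(v,z)·(v',z') = (v+v', z+z'+2⁻¹ ω(v,v'))` with `ω((t,w),(t',w')) = t w' - w t'`. -/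
def hMul {p : ℕ} (a b : (ZMod p × ZMod p) × ZMod p) : (ZMod p × ZMod p) × ZMod p :=
  (a.1 + b.1, a.2 + b.2 + (2 : ZMod p)⁻¹ * (a.1.1 * b.1.2 - a.1.2 * b.1.1))

/-- The additive character `ψ(z) = exp(2πi z/p)`. -/
def psi (p : ℕ) (z : ZMod p) : ℂ :=
  Complex.exp (2 * Real.pi * Complex.I * (z.val : ℂ) / p)

/-- The standard realization of the Heisenberg representation:
`(π((t,w),z) f)(x) = ψ(z + 2⁻¹ t w + w x) f(x+t)`. -/
def heis (p : ℕ) (h : (ZMod p × ZMod p) × ZMod p) :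
    (ZMod p → ℂ) →ₗ[ℂ] (ZMod p → ℂ) where
  toFun f x := psi p (h.2 + (2 : ZMod p)⁻¹ * h.1.1 * h.1.2 + h.1.2 * x) * f (x + h.1.1)
  map_add' f g := by funext x; simp [mul_add]
  map_smul' c f := by funext x; simp [Pi.smul_apply, smul_eq_mul]; ring

theorem psi_eq_stdAddChar (p : ℕ) [NeZero p] (z : ZMod p) : psi p z = ZMod.stdAddChar z := by
  have h := ZMod.stdAddChar_coe (N := p) (z.val : ℤ)
  simp only [Int.cast_natCast, ZMod.natCast_zmod_val] at h
  rw [h, psi]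

theorem psi_zero (p : ℕ) [NeZero p] : psi p 0 = 1 := by
  rw [psi_eq_stdAddChar, AddChar.map_zero_eq_one]

theorem psi_add (p : ℕ) [NeZero p] (a b : ZMod p) : psi p (a + b) = psi p a * psi p b := by
  simp only [psi_eq_stdAddChar, AddChar.map_add_eq_mul]

theorem sum_psi_mul (p : ℕ) [NeZero p] (b : ZMod p) :
    ∑ x : ZMod p, psi p (x * b) = if b = 0 then (p : ℂ) else 0 := by
  simp only [psi_eq_stdAddChar]
  rw [AddChar.sum_mulShift b (ZMod.isPrimitive_stdAddChar p)]
  simp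

theorem two_inv_add_two_inv {p : ℕ} [Fact p.Prime] (hp : p ≠ 2) :
    (2 : ZMod p)⁻¹ + 2⁻¹ = 1 := by
  have h : (2 : ZMod p) ≠ 0 := by
    intro h
    have h2 : ((2 : ℕ) : ZMod p) = 0 := by exact_mod_cast h
    rw [ZMod.natCast_eq_zero_iff] at h2
    exact hp ((Nat.prime_dvd_prime_iff_eq Fact.out Nat.prime_two).1 h2)
  rw [← two_mul, mul_inv_cancel₀ h]

section CentralCharacter

variable {p : ℕ} [Fact p.Prime] {V : Type*} [AddCommGroup V] [Module ℂ V]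
  {τ : (ZMod p × ZMod p) × ZMod p → V →ₗ[ℂ] V}

/-- A vector fixed by all modulations is sent by the representation to translates of itself,
by the formula for delta functions in the standard realization. -/
theorem apply_translate (hp : p ≠ 2) (hhom : ∀ a b, τ (hMul a b) = τ a ∘ₗ τ b)
    (hcen : ∀ z : ZMod p, τ ((0, 0), z) = psi p z • LinearMap.id)
    {e : V} (he : ∀ w, τ ((0, w), 0) e = e) (t w z s : ZMod p) :
    τ ((t, w), z) (τ ((s, 0), 0) e)
      = psi p (z - w * s - 2⁻¹ * t * w) • τ ((t + s, 0), 0) e := by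
  have hmul : hMul ((t, w), z) ((s, 0), 0)
      = hMul ((0, 0), z - w * s - 2⁻¹ * t * w) (hMul ((t + s, 0), 0) ((0, w), 0)) := by
    simp only [hMul, Prod.mk_add_mk, Prod.mk.injEq]
    refine ⟨⟨by ring, by ring⟩, ?_⟩
    linear_combination -(w * s) * two_inv_add_two_inv hp
  have h := congrArg (fun a => τ a e) hmul
  simpa [hhom, hcen, he] using h

/-- The isotypic components of the modulation subgroup span `V`, and the translations permute them
transitively, so a nonzero `V` has a nonzero vector fixed by all modulations. -/
theorem exists_fixed_ne_zero [Nontrivial V] (hp : p ≠ 2)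
    (hhom : ∀ a b, τ (hMul a b) = τ a ∘ₗ τ b)
    (hcen : ∀ z : ZMod p, τ ((0, 0), z) = psi p z • LinearMap.id) :
    ∃ e : V, e ≠ 0 ∧ ∀ w, τ ((0, w), 0) e = e := by
  obtain ⟨v, hv⟩ := exists_ne (0 : V)
  have h0 (u : V) : τ ((0, 0), 0) u = u := by simp [hcen, psi_zero]
  have hMM (a b : ZMod p) (u : V) : τ ((0, a), 0) (τ ((0, b), 0) u) = τ ((0, a + b), 0) u := by
    rw [← LinearMap.comp_apply, ← hhom]
    simp [hMul]
  have hMT (w t : ZMod p) (u : V) :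
      τ ((0, w), 0) (τ ((t, 0), 0) u) = psi p (-(w * t)) • τ ((t, 0), 0) (τ ((0, w), 0) u) := by
    have hmul : hMul ((0, w), 0) ((t, 0), 0)
        = hMul ((0, 0), -(w * t)) (hMul ((t, 0), 0) ((0, w), 0)) := by
      simp only [hMul, Prod.mk_add_mk, Prod.mk.injEq]
      refine ⟨⟨by ring, by ring⟩, ?_⟩
      linear_combination -(w * t) * two_inv_add_two_inv hp
    have h := congrArg (fun a => τ a u) hmul
    simpa [hhom, hcen] using h
  let P (y : ZMod p) : V := ∑ w : ZMod p, psi p (w * -y) • τ ((0, w), 0) v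
  have hsum : ∑ y, P y = (p : ℂ) • v := by
    simp only [P]
    rw [Finset.sum_comm]
    simp only [← Finset.sum_smul]
    have h (w : ZMod p) : ∑ y : ZMod p, psi p (w * -y) = if w = 0 then (p : ℂ) else 0 := by
      simpa [mul_comm w] using sum_psi_mul p (-w)
    simp only [h, ite_smul]
    simp [h0]
  have hP (a y : ZMod p) : τ ((0, a), 0) (P y) = psi p (a * y) • P y := by
    simp only [P, map_sum, map_smul, hMM, Finset.smul_sum, smul_smul, ← psi_add]
    refine Fintype.sum_equiv (Equiv.addLeft a) _ _ fun w => ?_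
    simp only [Equiv.coe_addLeft]
    ring_nf
  obtain ⟨y, hy⟩ : ∃ y, P y ≠ 0 := by
    by_contra! h
    have hp0 : (p : ℂ) ≠ 0 := Nat.cast_ne_zero.2 (NeZero.ne p)
    simp only [h, Finset.sum_const_zero] at hsum
    exact smul_ne_zero hp0 hv hsum.symm
  refine ⟨τ ((y, 0), 0) (P y), fun h => hy ?_, fun w => ?_⟩
  · have h' : τ ((-y, 0), 0) (τ ((y, 0), 0) (P y)) = P y := by
      rw [← LinearMap.comp_apply, ← hhom]
      simpa [hMul] using h0 (P y)
    rw [← h', h, map_zero]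
  · rw [hMT, hP, map_smul, smul_smul, ← psi_add]
    simp [psi_zero]

/-- The map `ℂ(ZMod p) → V` sending the delta function at `y` to the translate of `e` by `-y`. -/
def intertwiner (τ : (ZMod p × ZMod p) × ZMod p → V →ₗ[ℂ] V) (e : V) : (ZMod p → ℂ) →ₗ[ℂ] V :=
  Fintype.linearCombination ℂ fun y => τ ((-y, 0), 0) e

theorem intertwiner_apply (e : V) (f : ZMod p → ℂ) :
    intertwiner τ e f = ∑ y, f y • τ ((-y, 0), 0) e :=
  Fintype.linearCombination_apply _ _ _

theorem intertwiner_heis (hp : p ≠ 2) (hhom : ∀ a b, τ (hMul a b) = τ a ∘ₗ τ b)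
    (hcen : ∀ z : ZMod p, τ ((0, 0), z) = psi p z • LinearMap.id)
    {e : V} (he : ∀ w, τ ((0, w), 0) e = e) (h : (ZMod p × ZMod p) × ZMod p) (f : ZMod p → ℂ) :
    intertwiner τ e (heis p h f) = τ h (intertwiner τ e f) := by
  obtain ⟨⟨t, w⟩, z⟩ := h
  simp only [intertwiner_apply, map_sum, map_smul, apply_translate hp hhom hcen he, smul_smul]
  refine Fintype.sum_equiv (Equiv.addRight t) _ _ fun x => ?_
  have harg : z - w * -(x + t) - 2⁻¹ * t * w = z + 2⁻¹ * t * w + w * x := by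
    linear_combination -(w * t) * two_inv_add_two_inv hp
  have htr : t + -(x + t) = -x := by ring
  simp only [heis, LinearMap.coe_mk, AddHom.coe_mk, Equiv.coe_addRight, harg, htr]
  rw [mul_comm]

theorem intertwiner_injective (hp : p ≠ 2) (hhom : ∀ a b, τ (hMul a b) = τ a ∘ₗ τ b)
    (hcen : ∀ z : ZMod p, τ ((0, 0), z) = psi p z • LinearMap.id)
    {e : V} (he0 : e ≠ 0) (he : ∀ w, τ ((0, w), 0) e = e) :
    Function.Injective (intertwiner τ e) := by
  rw [injective_iff_map_eq_zero]
  intro f hf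
  funext y
  have hne : τ ((-y, 0), 0) e ≠ 0 := by
    intro h
    have h' := apply_translate hp hhom hcen he y 0 0 (-y)
    rw [h, map_zero] at h'
    simp [psi_zero, he] at h'
    exact he0 h'.symm
  have hproj : ∑ w : ZMod p, psi p (w * -y) • τ ((0, w), 0) (intertwiner τ e f)
      = ((p : ℂ) * f y) • τ ((-y, 0), 0) e := by
    have hterm (w x : ZMod p) :
        psi p (w * -y) • f x • τ ((0, w), 0) (τ ((-x, 0), 0) e)
          = psi p (w * (x - y)) • f x • τ ((-x, 0), 0) e := by
      rw [apply_translate hp hhom hcen he, smul_comm (f x), smul_smul, ← psi_add]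
      ring_nf
    simp only [intertwiner_apply, map_sum, map_smul, Finset.smul_sum, hterm]
    rw [Finset.sum_comm]
    simp only [← Finset.sum_smul, sum_psi_mul, sub_eq_zero]
    simp [ite_smul, smul_smul]
  have hp0 : (p : ℂ) ≠ 0 := Nat.cast_ne_zero.2 (NeZero.ne p)
  simp only [hf, map_zero, smul_zero, Finset.sum_const_zero] at hproj
  simpa [hp0, hne] using hproj.symm

end CentralCharacter

/-- Stone–von Neumann theorem: any irreducible representation of the Heisenberg group
with central character `ψ` is isomorphic to the standard realization. -/
theorem stmt3 (p : ℕ) [Fact p.Prime] (hp : p ≠ 2)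
    (V : Type) [AddCommGroup V] [Module ℂ V] [FiniteDimensional ℂ V] [Nontrivial V]
    (τ : (ZMod p × ZMod p) × ZMod p → V →ₗ[ℂ] V)
    (hhom : ∀ a b, τ (hMul a b) = τ a ∘ₗ τ b)
    (hcen : ∀ z : ZMod p, τ ((0, 0), z) = psi p z • LinearMap.id)
    (hirr : ∀ W : Submodule ℂ V, (∀ h v, v ∈ W → τ h v ∈ W) → W = ⊥ ∨ W = ⊤) :
    ∃ Φ : (ZMod p → ℂ) ≃ₗ[ℂ] V, ∀ h f, Φ (heis p h f) = τ h (Φ f) := by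
  obtain ⟨e, he0, he⟩ := exists_fixed_ne_zero hp hhom hcen
  have hinj := intertwiner_injective hp hhom hcen he0 he
  have hint := intertwiner_heis hp hhom hcen he
  have hsurj : LinearMap.range (intertwiner τ e) = ⊤ := by
    refine (hirr _ ?_).resolve_left fun h => ?_
    · rintro h _ ⟨f, rfl⟩
      exact ⟨heis p h f, hint h f⟩
    · have h1 : intertwiner τ e 1 = intertwiner τ e 0 := by simp [LinearMap.range_eq_bot.1 h]
      exact one_ne_zero (hinj h1)
  exact ⟨LinearEquiv.ofBijective _ ⟨hinj, LinearMap.range_eq_top.1 hsurj⟩, hint⟩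

end DFTWeil
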